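/- arXiv:2309.05340 — 2 statements merged into one kernel-verified Lean document; each statement's English description precedes it below -/
import Mathlib

section
/- Let j ∈ [n] and let m be a positive integer. Let k₁, k₂, …, k_m be m (not necessarily distinct) elements of [j] satisfying m ≥ j − k_m + 1. Then in k[S_n] we have [t_{k₁}, t_j] · [t_{k₂}, t_j] · ⋯ · [t_{k_m}, t_j] = 0. -/
/-- The simple transposition `s_i ∈ S_n` (1-based indexing), swapping `i` and `i+1`,
defined as the identity for `i` outside `{1, …, n-1}`. -/
def simpleTransposition (n i : ℕ) : Equiv.Perm (Fin n) :=
  if h : 1 ≤ i ∧ i < n then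
    Equiv.swap ⟨i - 1, by omega⟩ ⟨i, h.2⟩
  else 1

/-- The cycle `(v ⟹ w) = s_v s_{v+1} ⋯ s_{w-1} ∈ S_n`, sending
`v ↦ v+1 ↦ ⋯ ↦ w ↦ v` (and equal to the identity when `v = w`). -/
def cyc (n v w : ℕ) : Equiv.Perm (Fin n) :=
  ((List.range' v (w - v)).map (simpleTransposition n)).prod

/-- The somewhere-to-below shuffle `t_ℓ = Σ_{w=ℓ}^{n} (ℓ ⟹ w)` in the group
algebra `R[S_n]`. -/
noncomputable def t (R : Type*) [CommRing R] (n ℓ : ℕ) :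
    MonoidAlgebra R (Equiv.Perm (Fin n)) :=
  ∑ w ∈ Finset.Icc ℓ n, MonoidAlgebra.of R (Equiv.Perm (Fin n)) (cyc n ℓ w)

open Equiv MonoidAlgebra

section Permutations

variable {n : ℕ}

theorem simpleTransposition_apply {i : ℕ} (hi : 1 ≤ i) (hin : i < n) (x : Fin n) :
    (simpleTransposition n i x : ℕ) =
      if (x : ℕ) + 1 = i then i else if (x : ℕ) = i then i - 1 else x := by
  rw [simpleTransposition, dif_pos ⟨hi, hin⟩, swap_apply_def]
  simp only [Fin.ext_iff]
  split_ifs <;> grind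

theorem simpleTransposition_apply_of_ne {i : ℕ} {x : Fin n} (h₁ : (x : ℕ) + 1 ≠ i)
    (h₂ : (x : ℕ) ≠ i) : simpleTransposition n i x = x := by
  rw [simpleTransposition]
  split_ifs with h
  · exact swap_apply_of_ne_of_ne (by simp [Fin.ext_iff]; omega) (by simp [Fin.ext_iff]; omega)
  · rfl

theorem simpleTransposition_mul_self (i : ℕ) :
    simpleTransposition n i * simpleTransposition n i = 1 := by
  rw [simpleTransposition]
  split_ifs <;> simp

theorem commute_simpleTransposition {σ : Perm (Fin n)} {i : ℕ}
    (h : ∀ x : Fin n, i ≤ x + 1 → σ x = x) {l : ℕ} (hl : i ≤ l) :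
    Commute σ (simpleTransposition n l) := by
  rw [simpleTransposition]
  split_ifs with hl'
  · rw [Commute, SemiconjBy, mul_swap_eq_swap_mul, h ⟨l - 1, _⟩ (by dsimp only; omega),
      h ⟨l, _⟩ (by dsimp only; omega)]
  · exact Commute.one_right σ

theorem eq_add_or_outside_window (p x : ℕ) :
    x = p ∨ x = p + 1 ∨ x = p + 2 ∨ x = p + 3 ∨ x = p + 4 ∨
    x = p + 5 ∨ (∃ r, x = p + 6 + r) ∨ ∃ r, p = x + 1 + r := by
  rcases lt_or_ge x p with h | h
  · obtain ⟨r, hr⟩ := Nat.exists_eq_add_of_lt h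
    have : ∃ r, p = x + 1 + r := ⟨r, by omega⟩
    tauto
  · obtain ⟨r, hr⟩ := Nat.exists_eq_add_of_le h
    by_cases h6 : 6 ≤ r
    · have : ∃ r, x = p + 6 + r := ⟨r - 6, by omega⟩
      tauto
    · omega

theorem simpleTransposition_braid {i : ℕ} (hi : 1 ≤ i) (hin : i + 1 < n) :
    simpleTransposition n i * simpleTransposition n (i + 1) * simpleTransposition n i =
      simpleTransposition n (i + 1) * simpleTransposition n i * simpleTransposition n (i + 1) := by
  ext x
  obtain ⟨p, rfl⟩ := Nat.exists_eq_add_of_le' hi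
  obtain h | h | h | h | h | h | ⟨r, h⟩ | ⟨r, rfl⟩ := eq_add_or_outside_window p x <;>
  simp +arith (disch := omega) [Perm.mul_apply, simpleTransposition_apply, *]

theorem commute_cyc {σ : Perm (Fin n)} {i : ℕ}
    (h : ∀ x : Fin n, i ≤ x + 1 → σ x = x) (w : ℕ) : Commute σ (cyc n i w) := by
  refine Commute.list_prod_right _ _ fun τ hτ => ?_
  obtain ⟨l, hl, rfl⟩ := List.mem_map.1 hτ
  exact commute_simpleTransposition h (List.mem_range'_1.1 hl).1

theorem cyc_self (i : ℕ) : cyc n i i = 1 := by simp [cyc]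

theorem cyc_of_lt {i w : ℕ} (h : i < w) :
    cyc n i w = simpleTransposition n i * cyc n (i + 1) w := by
  obtain ⟨d, rfl⟩ := Nat.exists_eq_add_of_lt h
  simp [cyc, show i + d + 1 - i = d + 1 by omega, show i + d + 1 - (i + 1) = d by omega,
    List.range'_succ]

theorem cyc_apply {i w : ℕ} (hi : 1 ≤ i) (hiw : i ≤ w) (hw : w ≤ n) (x : Fin n) :
    (cyc n i w x : ℕ) = if (x : ℕ) + 1 = w then i - 1
      else if i ≤ (x : ℕ) + 1 ∧ (x : ℕ) + 1 < w then x + 1 else x := by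
  induction hiw using Nat.decreasingInduction with
  | self => rw [cyc_self, Perm.one_apply]; split_ifs <;> omega
  | of_succ l hl ih =>
    rw [cyc_of_lt hl, Perm.mul_apply, simpleTransposition_apply hi (by omega), ih (by omega)]
    split_ifs <;> omega

/-- The permutation exchanging the blocks `{i, i+1}` and `{i+2, i+3}`. -/
def blockSwap (n i : ℕ) : Perm (Fin n) :=
  simpleTransposition n (i + 1) * simpleTransposition n (i + 2) *
    simpleTransposition n i * simpleTransposition n (i + 1)

theorem blockSwap_apply {i : ℕ} (hi : 1 ≤ i) (hin : i + 2 < n) (x : Fin n) :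
    (blockSwap n i x : ℕ) = if i ≤ (x : ℕ) + 1 ∧ (x : ℕ) + 1 ≤ i + 1 then (x : ℕ) + 2
      else if i + 2 ≤ (x : ℕ) + 1 ∧ (x : ℕ) + 1 ≤ i + 3 then (x : ℕ) - 2 else x := by
  simp only [blockSwap, Perm.mul_apply, simpleTransposition_apply hi (by omega : i < n),
    simpleTransposition_apply (by omega : 1 ≤ i + 1) (by omega : i + 1 < n),
    simpleTransposition_apply (by omega : 1 ≤ i + 2) hin]
  grind

theorem blockSwap_mul_self {i : ℕ} (hi : 1 ≤ i) (hin : i + 2 < n) :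
    blockSwap n i * blockSwap n i = 1 := by
  ext x
  obtain ⟨p, rfl⟩ := Nat.exists_eq_add_of_le' hi
  obtain h | h | h | h | h | h | ⟨r, h⟩ | ⟨r, rfl⟩ := eq_add_or_outside_window p x <;>
  simp +arith (disch := omega) [Perm.mul_apply, blockSwap_apply, *]

theorem blockSwap_mul_simpleTransposition {i : ℕ} (hi : 1 ≤ i) (hin : i + 2 < n) :
    blockSwap n i * simpleTransposition n i = simpleTransposition n (i + 2) * blockSwap n i := by
  ext x
  obtain ⟨p, rfl⟩ := Nat.exists_eq_add_of_le' hi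
  obtain h | h | h | h | h | h | ⟨r, h⟩ | ⟨r, rfl⟩ := eq_add_or_outside_window p x <;>
  simp +arith (disch := omega) [Perm.mul_apply, blockSwap_apply, simpleTransposition_apply, *]

theorem simpleTransposition_mul_blockSwap_twice {i : ℕ} (hi : 1 ≤ i) (hin : i + 3 < n) :
    simpleTransposition n i * blockSwap n (i + 1) * simpleTransposition n i * blockSwap n (i + 1) =
      blockSwap n (i + 1) * simpleTransposition n i * blockSwap n (i + 1) *
        (simpleTransposition n (i + 1) * simpleTransposition n (i + 2) *
          simpleTransposition n (i + 1)) := by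
  ext x
  obtain ⟨p, rfl⟩ := Nat.exists_eq_add_of_le' hi
  obtain h | h | h | h | h | h | ⟨r, h⟩ | ⟨r, rfl⟩ := eq_add_or_outside_window p x <;>
  simp +arith (disch := omega) [Perm.mul_apply, blockSwap_apply, simpleTransposition_apply, *]

theorem simpleTransposition_commute_blockSwap_conj {i : ℕ} (hi : 1 ≤ i) (hin : i + 3 < n) :
    simpleTransposition n (i + 1) *
        (blockSwap n (i + 1) * simpleTransposition n i * blockSwap n (i + 1)) =
      blockSwap n (i + 1) * simpleTransposition n i * blockSwap n (i + 1) *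
        simpleTransposition n (i + 1) := by
  ext x
  obtain ⟨p, rfl⟩ := Nat.exists_eq_add_of_le' hi
  obtain h | h | h | h | h | h | ⟨r, h⟩ | ⟨r, rfl⟩ := eq_add_or_outside_window p x <;>
  simp +arith (disch := omega) [Perm.mul_apply, blockSwap_apply, simpleTransposition_apply, *]

theorem simpleTransposition_blockSwap_exchange {i : ℕ} (hi : 1 ≤ i) (hin : i + 4 < n) :
    simpleTransposition n i * simpleTransposition n (i + 1) * simpleTransposition n i *
        blockSwap n (i + 2) * simpleTransposition n (i + 1) * simpleTransposition n i =
      blockSwap n (i + 2) * simpleTransposition n (i + 1) * simpleTransposition n i *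
        blockSwap n (i + 2) * simpleTransposition n (i + 1) * blockSwap n (i + 2) := by
  ext x
  obtain ⟨p, rfl⟩ := Nat.exists_eq_add_of_le' hi
  obtain h | h | h | h | h | h | ⟨r, h⟩ | ⟨r, rfl⟩ := eq_add_or_outside_window p x <;>
  simp +arith (disch := omega) [Perm.mul_apply, blockSwap_apply, simpleTransposition_apply, *]

end Permutations

section GroupAlgebra

variable (R : Type*) [CommRing R] (n : ℕ)

/-- The simple transposition `s_i` as an element of the group algebra. -/
noncomputable def sElem (i : ℕ) : MonoidAlgebra R (Perm (Fin n)) :=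
  of R (Perm (Fin n)) (simpleTransposition n i)

variable {n}

theorem sElem_mul_self (i : ℕ) : sElem R n i * sElem R n i = 1 := by
  rw [sElem, ← map_mul, simpleTransposition_mul_self, map_one]

theorem sElem_braid {i : ℕ} (hi : 1 ≤ i) (hin : i + 1 < n) :
    sElem R n i * sElem R n (i + 1) * sElem R n i =
      sElem R n (i + 1) * sElem R n i * sElem R n (i + 1) := by
  simp only [sElem, ← map_mul, simpleTransposition_braid hi hin]

theorem t_of_lt {i : ℕ} (h : n < i) : t R n i = 0 := by
  simp [t, h]

theorem t_eq_one_add {i : ℕ} (h : i ≤ n) : t R n i = 1 + sElem R n i * t R n (i + 1) := by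
  rw [t, t, Finset.Icc_eq_cons_Ioc h, Finset.sum_cons, cyc_self, map_one, Finset.mul_sum]
  congr 1
  refine Finset.sum_congr (by ext; simp) fun w hw => ?_
  rw [cyc_of_lt (Finset.mem_Ioc.1 (by simpa using hw)).1, map_mul, sElem]

theorem commute_of_t {σ : Perm (Fin n)} {i : ℕ} (h : ∀ x : Fin n, i ≤ x + 1 → σ x = x) :
    Commute (of R (Perm (Fin n)) σ) (t R n i) :=
  Commute.sum_right _ _ _ fun w _ => (commute_cyc h w).map (of R (Perm (Fin n)))

theorem commute_sElem_t {i l : ℕ} (h : i + 1 < l) : Commute (sElem R n i) (t R n l) :=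
  commute_of_t R fun x hx => simpleTransposition_apply_of_ne (by omega) (by omega)

theorem commute_sElem_sElem {i l : ℕ} (h : i + 1 < l) :
    Commute (sElem R n i) (sElem R n l) :=
  (commute_simpleTransposition (i := l)
    (fun x hx => simpleTransposition_apply_of_ne (by omega) (by omega)) le_rfl).map
      (of R (Perm (Fin n)))

theorem sElem_mul_t_mul_t {i : ℕ} (hi : 1 ≤ i) (hin : i ≤ n) :
    sElem R n i * t R n (i + 1) * t R n i = t R n (i + 1) * t R n i := by
  induction hin using Nat.decreasingInduction with
  | self => simp [t_of_lt R (Nat.lt_succ_self n)]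
  | of_succ i h ih =>
    specialize ih (by omega)
    have hT := t_eq_one_add R h.le
    have hU : t R n (i + 1) = 1 + sElem R n (i + 1) * t R n (i + 2) := t_eq_one_add R h
    have hc := commute_sElem_t (n := n) R (show i + 1 < i + 2 by omega)
    have hs := sElem_mul_self R (n := n) i
    rw [hT]
    by_cases hin : i + 1 < n
    · have hb := sElem_braid R hi hin
      rw [show i + 1 + 1 = i + 2 by omega] at ih
      rw [hU] at ih ⊢
      generalize t R n (i + 2) = V at *
      generalize sElem R n i = c at *
      generalize sElem R n (i + 1) = d at *
      linear_combination (norm := noncomm_ring) (1 - c) * d * hc.eq * (1 + d * V) +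
        hs * (1 + d * V) + hb * V * (1 + d * V) + d * c * ih
    · rw [hU, t_of_lt R (by omega : n < i + 2)]
      linear_combination (norm := noncomm_ring) hs

theorem t_mul_one_sub {i : ℕ} (hi : 1 ≤ i) :
    t R n i * (1 - sElem R n i) =
      sElem R n i * sElem R n (i + 1) * (1 - sElem R n i) * t R n (i + 2) := by
  rcases lt_or_ge i n with h | h
  · have hc := commute_sElem_t (n := n) R (show i + 1 < i + 2 by omega)
    have hs := sElem_mul_self R (n := n) i
    have hU : t R n (i + 1) = 1 + sElem R n (i + 1) * t R n (i + 2) := t_eq_one_add R h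
    rw [t_eq_one_add R h.le, hU]
    linear_combination (norm := noncomm_ring)
      sElem R n i * sElem R n (i + 1) * hc.eq - hs
  · rw [t_of_lt R (by omega : n < i + 2)]
    rcases h.eq_or_lt with rfl | h
    · rw [show sElem R n n = 1 by rw [sElem, simpleTransposition, dif_neg (by omega), map_one]]
      simp
    · simp [t_of_lt R h]

theorem t_mul_t_mul_one_sub {i : ℕ} (hi : 1 ≤ i) :
    t R n (i + 1) * t R n i * (1 - sElem R n i) =
      of R _ (blockSwap n i) * (1 - sElem R n i) * (t R n (i + 3) * t R n (i + 2)) := by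
  rw [mul_assoc, t_mul_one_sub R hi]
  by_cases h : i + 1 < n
  · have hb := sElem_braid R hi h
    have h1 := t_mul_one_sub R (n := n) (show 1 ≤ i + 1 by omega)
    have hc := commute_sElem_t (n := n) R (show i + 1 < i + 3 by omega)
    have hc' := commute_sElem_t (n := n) R (show i + 1 + 1 < i + 3 by omega)
    have hp : of R _ (blockSwap n i) = sElem R n (i + 1) * sElem R n (i + 2) *
        sElem R n i * sElem R n (i + 1) := by
      simp only [sElem, blockSwap, map_mul]
    rw [hp]
    rw [show i + 1 + 1 = i + 2 by omega, show i + 1 + 2 = i + 3 by omega] at *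
    generalize t R n (i + 2) = V at *
    generalize t R n (i + 3) = W at *
    generalize t R n (i + 1) = U at *
    generalize sElem R n i = c at *
    generalize sElem R n (i + 1) = d at *
    generalize sElem R n (i + 2) = e at *
    linear_combination (norm := noncomm_ring) -U * hb * V + h1 * c * d * V -
      d * e * (1 - d) * (hc.eq * d + c * hc'.eq) * V + d * e * hb * W * V
  · simp [t_of_lt R (by omega : n < i + 2)]

theorem commutator_eq {i : ℕ} (hi : 1 ≤ i) (hin : i + 1 ≤ n) :
    t R n i * t R n (i + 1) - t R n (i + 1) * t R n i =
      (1 - sElem R n (i + 1)) * sElem R n i * (t R n (i + 2) * t R n (i + 1)) := by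
  have hT := t_eq_one_add R (show i ≤ n by omega)
  have hU : t R n (i + 1) = 1 + sElem R n (i + 1) * t R n (i + 2) := t_eq_one_add R hin
  have hc := commute_sElem_t (n := n) R (show i + 1 < i + 2 by omega)
  have hs : sElem R n (i + 1) * t R n (i + 2) * t R n (i + 1) = t R n (i + 2) * t R n (i + 1) :=
    sElem_mul_t_mul_t R (by omega) hin
  rw [hT]
  generalize t R n (i + 2) = V at *
  generalize sElem R n i = b at *
  generalize sElem R n (i + 1) = c at *
  generalize t R n (i + 1) = T at *
  linear_combination (norm := noncomm_ring) b * hU * T - hU * b * T + b * hs + c * hc.eq * T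

/-- The two pairs of letters drawn by consecutive commutators are exchangeable. -/
theorem sElem_mul_t_four {i l : ℕ} (hi : 1 ≤ i) (hin : i + 3 ≤ n) (hl : i ≤ l) (hl' : l ≤ i + 2) :
    sElem R n l * (t R n (i + 3) * t R n (i + 2) * (t R n (i + 1) * t R n i)) =
      t R n (i + 3) * t R n (i + 2) * (t R n (i + 1) * t R n i) := by
  have hs := sElem_mul_t_mul_t R (n := n) (show 1 ≤ l by omega) (by omega)
  obtain rfl | rfl | rfl : l = i ∨ l = i + 1 ∨ l = i + 2 := by omega
  · have h2 := commute_sElem_t (n := n) R (show l + 1 < l + 2 by omega)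
    have h3 := commute_sElem_t (n := n) R (show l + 1 < l + 3 by omega)
    linear_combination (norm := noncomm_ring) h3.eq * t R n (l + 2) * t R n (l + 1) * t R n l +
      t R n (l + 3) * h2.eq * t R n (l + 1) * t R n l + t R n (l + 3) * t R n (l + 2) * hs
  · have h3 := commute_sElem_t (n := n) R (show i + 1 + 1 < i + 3 by omega)
    rw [show i + 1 + 1 = i + 2 by omega] at hs
    linear_combination (norm := noncomm_ring) h3.eq * t R n (i + 2) * t R n (i + 1) * t R n i +
      t R n (i + 3) * hs * t R n i
  · rw [show i + 2 + 1 = i + 3 by omega] at hs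
    linear_combination (norm := noncomm_ring) hs * t R n (i + 1) * t R n i

theorem blockSwap_mul_t_four {i : ℕ} (hi : 1 ≤ i) (hin : i + 3 ≤ n) :
    of R _ (blockSwap n i) * (t R n (i + 3) * t R n (i + 2) * (t R n (i + 1) * t R n i)) =
      t R n (i + 3) * t R n (i + 2) * (t R n (i + 1) * t R n i) := by
  have h := fun l => sElem_mul_t_four R (l := l) hi hin
  simp only [sElem] at h
  simp only [blockSwap, map_mul]
  rw [mul_assoc, mul_assoc, mul_assoc, h _ (by omega) (by omega), h _ (by omega) (by omega),
    h _ (by omega) (by omega), h _ (by omega) (by omega)]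

theorem commutator_mul_commutator {i : ℕ} (hi : 1 ≤ i) (hin : i + 1 ≤ n) :
    (t R n i * t R n (i + 1) - t R n (i + 1) * t R n i) *
      (t R n i * t R n (i + 1) - t R n (i + 1) * t R n i) = 0 := by
  rw [commutator_eq R hi hin]
  have hT : t R n (i + 2) * t R n (i + 1) * (1 - sElem R n (i + 1)) =
      of R _ (blockSwap n (i + 1)) * (1 - sElem R n (i + 1)) * (t R n (i + 4) * t R n (i + 3)) :=
    t_mul_t_mul_one_sub R (by omega)
  by_cases hn : i + 3 < n
  · have hc := (commute_sElem_t (n := n) R (show i + 1 < i + 4 by omega)).mul_right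
      (commute_sElem_t (n := n) R (show i + 1 < i + 3 by omega))
    have hY : _ * (t R n (i + 4) * t R n (i + 3) * (t R n (i + 2) * t R n (i + 1))) = _ :=
      blockSwap_mul_t_four R (show 1 ≤ i + 1 by omega) hn
    have hl (l : ℕ) (h : i + 1 ≤ l) (h' : l ≤ i + 3) : sElem R n l *
        (t R n (i + 4) * t R n (i + 3) * (t R n (i + 2) * t R n (i + 1))) = _ :=
      sElem_mul_t_four R (show 1 ≤ i + 1 by omega) hn h h'
    have hYc := hl (i + 1) (by omega) (by omega)
    have hYd := hl (i + 2) (by omega) (by omega)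
    have hce := commute_sElem_sElem R (n := n) (show i + 1 + 1 < i + 3 by omega)
    have hbe := commute_sElem_sElem R (n := n) (show i + 1 < i + 3 by omega)
    have hp := congrArg (of R _)
      (blockSwap_mul_simpleTransposition (show 1 ≤ i + 1 by omega) (show i + 1 + 2 < n by omega))
    have hg := congrArg (of R _) (simpleTransposition_mul_blockSwap_twice hi hn)
    have hz := congrArg (of R _) (simpleTransposition_commute_blockSwap_conj hi hn)
    rw [show i + 1 + 2 = i + 3 by omega] at hp
    simp only [map_mul] at hp hg hz
    unfold sElem at *
    generalize of R _ (blockSwap n (i + 1)) = p at *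
    generalize of R _ (simpleTransposition n i) = b at *
    generalize of R _ (simpleTransposition n (i + 1)) = c at *
    generalize of R _ (simpleTransposition n (i + 2)) = d at *
    generalize of R _ (simpleTransposition n (i + 3)) = e at *
    generalize t R n (i + 2) * t R n (i + 1) = T at *
    generalize t R n (i + 4) * t R n (i + 3) = W at *
    have h1 : b * p * b * (W * T) = p * b * p * (W * T) := by
      linear_combination (norm := noncomm_ring) - b * p * b * hY + hg * (W * T) +
        p * b * p * c * d * hYc + p * b * p * c * hYd + p * b * p * hYc
    linear_combination (norm := noncomm_ring) (1 - c) * b * hT * b * T -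
      (1 - c) * b * p * (1 - c) * hc.eq * T - (1 - c) * b * hp * b * (W * T) -
      (1 - c) * hbe.eq * p * b * (W * T) + (1 - c) * (1 - e) * h1 +
      hce.eq * p * b * p * (W * T) -
      (1 - e) * hz * (W * T) - (1 - e) * p * b * p * hYc
  · rw [t_of_lt R (by omega : n < i + 4)] at hT
    linear_combination (norm := noncomm_ring) (1 - sElem R n (i + 1)) * sElem R n i * hT *
      sElem R n i * (t R n (i + 2) * t R n (i + 1))

theorem commutator_mul_sElem_mul_commutator {i : ℕ} (hi : 1 ≤ i) (hin : i + 2 ≤ n)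
    {x : MonoidAlgebra R (Perm (Fin n))}
    (hx : (t R n (i + 1) * t R n (i + 2) - t R n (i + 2) * t R n (i + 1)) *
      (sElem R n i * x) = 0) :
    (t R n (i + 1) * t R n (i + 2) - t R n (i + 2) * t R n (i + 1)) * (sElem R n i *
      ((t R n (i + 1) * t R n (i + 2) - t R n (i + 2) * t R n (i + 1)) * x)) = 0 := by
  have hC : t R n (i + 1) * t R n (i + 2) - t R n (i + 2) * t R n (i + 1) =
      (1 - sElem R n (i + 2)) * sElem R n (i + 1) * (t R n (i + 3) * t R n (i + 2)) :=
    commutator_eq R (by omega) hin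
  rw [hC] at hx ⊢
  have hT : t R n (i + 3) * t R n (i + 2) * (1 - sElem R n (i + 2)) =
      of R _ (blockSwap n (i + 2)) * (1 - sElem R n (i + 2)) * (t R n (i + 5) * t R n (i + 4)) :=
    t_mul_t_mul_one_sub R (by omega)
  have haT := (commute_sElem_t (n := n) R (show i + 1 < i + 3 by omega)).mul_right
    (commute_sElem_t (n := n) R (show i + 1 < i + 2 by omega))
  have hac := commute_sElem_sElem R (n := n) (show i + 1 < i + 2 by omega)
  by_cases hn : i + 4 < n
  · have haW := (commute_sElem_t (n := n) R (show i + 1 < i + 5 by omega)).mul_right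
      (commute_sElem_t (n := n) R (show i + 1 < i + 4 by omega))
    have hbW := (commute_sElem_t (n := n) R (show i + 1 + 1 < i + 5 by omega)).mul_right
      (commute_sElem_t (n := n) R (show i + 1 + 1 < i + 4 by omega))
    have hY : _ * (t R n (i + 5) * t R n (i + 4) * (t R n (i + 3) * t R n (i + 2))) = _ :=
      blockSwap_mul_t_four R (show 1 ≤ i + 2 by omega) hn
    have hae := commute_sElem_sElem R (n := n) (show i + 1 < i + 4 by omega)
    have hbe := commute_sElem_sElem R (n := n) (show i + 1 + 1 < i + 4 by omega)
    have hce := commute_sElem_sElem R (n := n) (show i + 2 + 1 < i + 4 by omega)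
    have hp := congrArg (of R _)
      (blockSwap_mul_simpleTransposition (show 1 ≤ i + 2 by omega) (show i + 2 + 2 < n by omega))
    have hpp := congrArg (of R _)
      (blockSwap_mul_self (show 1 ≤ i + 2 by omega) (show i + 2 + 2 < n by omega))
    have hg := congrArg (of R _) (simpleTransposition_blockSwap_exchange hi hn)
    rw [show i + 2 + 2 = i + 4 by omega] at hp
    simp only [map_mul, map_one] at hp hpp hg
    unfold sElem at *
    generalize of R _ (blockSwap n (i + 2)) = p at *
    generalize of R _ (simpleTransposition n i) = a at *
    generalize of R _ (simpleTransposition n (i + 1)) = b at *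
    generalize of R _ (simpleTransposition n (i + 2)) = c at *
    generalize of R _ (simpleTransposition n (i + 4)) = e at *
    generalize t R n (i + 3) * t R n (i + 2) = T at *
    generalize t R n (i + 5) * t R n (i + 4) = W at *
    have hCaC : (1 - c) * b * T * a * ((1 - c) * b * T) =
        (1 - c) * b * a * p * (1 - c) * b * (W * T) := by
      linear_combination (norm := noncomm_ring) (1 - c) * b * a * hT * b * T -
        (1 - c) * b * haT.eq * (1 - c) * b * T - (1 - c) * b * a * p * (1 - c) * hbW.eq * T
    have hp' : p * (1 - c) = (1 - e) * p := by
      linear_combination (norm := noncomm_ring) - hp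
    have hp'' : p * (1 - e) = (1 - c) * p := by
      linear_combination (norm := noncomm_ring) p * hp * p - hpp * c * p + p * e * hpp
    have hL : (1 - c) * b * a * p * (1 - c) * b * (W * T) =
      p * a * ((1 - c) * b * a * p * (1 - c) * b * (W * T)) * a := by
      have haY : a * (W * T) = W * T * a := (haW.mul_right haT).eq
      have hleft : (1 - c) * b * a * p * (1 - c) * b * (W * T) =
          (1 - c) * (1 - e) * b * a * p * b * (W * T) := by
        linear_combination (norm := noncomm_ring) (1 - c) * b * a * hp' * b * (W * T) -
          (1 - c) * b * hae.eq * p * b * (W * T) - (1 - c) * hbe.eq * a * p * b * (W * T)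
      have hright : a * ((1 - c) * (1 - e) * b * a * p * b * (W * T)) * a =
          (1 - c) * (1 - e) * p * b * a * p * b * (W * T) := by
        linear_combination (norm := noncomm_ring)
          - a * (1 - c) * (1 - e) * b * a * p * b * haY -
          hac.eq * (1 - e) * b * a * p * b * a * (W * T) -
          (1 - c) * hae.eq * b * a * p * b * a * (W * T) +
          (1 - c) * (1 - e) * hg * (W * T) + (1 - c) * (1 - e) * p * b * a * p * b * hY
      rw [hleft]
      linear_combination (norm := noncomm_ring) - p * hright -
        hp' * (1 - e) * p * b * a * p * b * (W * T) -
        (1 - e) * hp'' * p * b * a * p * b * (W * T) -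
        (1 - e) * (1 - c) * hpp * b * a * p * b * (W * T) + hce.eq * b * a * p * b * (W * T)
    have : (1 - c) * b * T * (a * ((1 - c) * b * T * x)) =
        p * a * ((1 - c) * b * T) * a * ((1 - c) * b * T * (a * x)) := by
      linear_combination (norm := noncomm_ring) hCaC * x + hL * x - p * a * hCaC * a * x
    rw [this, hx, mul_zero]
  · rw [t_of_lt R (by omega : n < i + 5)] at hT
    generalize t R n (i + 3) * t R n (i + 2) = T at *
    generalize sElem R n i = a at *
    generalize sElem R n (i + 1) = b at *
    generalize sElem R n (i + 2) = c at *
    linear_combination (norm := noncomm_ring) (1 - c) * b * a * hT * b * T * x -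
      (1 - c) * b * haT.eq * (1 - c) * b * T * x

end GroupAlgebra

section Nilpotency

variable (R : Type*) [CommRing R] {n : ℕ}

/-- The commutator `[t_i, t_j]`. -/
noncomputable def tComm (n i j : ℕ) : MonoidAlgebra R (Perm (Fin n)) :=
  t R n i * t R n j - t R n j * t R n i

theorem tComm_eq_cyc_mul {i l : ℕ} (hl : l ≤ i) (hi : i < n) :
    tComm R n l (i + 1) = of R _ (cyc n l i) * tComm R n i (i + 1) := by
  induction hl using Nat.decreasingInduction with
  | self => rw [cyc_self, map_one, one_mul]
  | of_succ l hl ih =>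
    have hc := commute_sElem_t (n := n) R (show l + 1 < i + 1 by omega)
    rw [cyc_of_lt hl, map_mul, mul_assoc, ← ih, tComm, tComm, t_eq_one_add R (by omega : l ≤ n)]
    change _ = sElem R n l * _
    linear_combination (norm := noncomm_ring) hc.eq * t R n (l + 1)

theorem commute_of_tComm {σ : Perm (Fin n)} {i : ℕ} (h : ∀ x : Fin n, i ≤ x + 1 → σ x = x) :
    Commute (of R (Perm (Fin n)) σ) (tComm R n i (i + 1)) :=
  have h₁ := commute_of_t R h
  have h₂ := commute_of_t R (i := i + 1) fun x hx => h x (by omega)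
  (h₁.mul_right h₂).sub_right (h₂.mul_right h₁)

/-- `a` is annihilated by `[t_i, t_{i+1}]` after moving position `x` to position `i` by any
permutation of the first `i` positions. -/
def IsAnnihilatedAt (i : ℕ) (x : Fin n) (a : MonoidAlgebra R (Perm (Fin n))) : Prop :=
  ∀ σ : Perm (Fin n), (∀ y : Fin n, i + 1 ≤ y + 1 → σ y = y) → (σ x : ℕ) + 1 = i →
    tComm R n i (i + 1) * (of R _ σ * a) = 0

variable {R}

theorem IsAnnihilatedAt.of_mul {i : ℕ} {x : Fin n} {a : MonoidAlgebra R (Perm (Fin n))}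
    (h : IsAnnihilatedAt R i x a) {π : Perm (Fin n)} (hπ : ∀ y : Fin n, i + 1 ≤ y + 1 → π y = y) :
    IsAnnihilatedAt R i (π x) (of R _ π * a) := fun σ hσ hx => by
  rw [← mul_assoc (of R _ σ), ← map_mul]
  exact h (σ * π) (fun y hy => by rw [Perm.mul_apply, hπ y hy, hσ y hy]) hx

theorem isAnnihilatedAt_tComm_mul_self {i : ℕ} (hi : 1 ≤ i) (hin : i < n) {x : Fin n}
    (hx : (x : ℕ) + 1 = i) (a : MonoidAlgebra R (Perm (Fin n))) :
    IsAnnihilatedAt R i x (tComm R n i (i + 1) * a) := fun σ hσ hσx => by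
  have hfix : ∀ y : Fin n, i ≤ y + 1 → σ y = y := fun y hy => by
    rcases hy.eq_or_lt with h | h
    · obtain rfl : y = x := Fin.ext (by omega)
      exact Fin.ext (by omega)
    · exact hσ y h
  rw [← mul_assoc (of R _ σ), (commute_of_tComm R hfix).eq, ← mul_assoc, ← mul_assoc, tComm,
    commutator_mul_commutator R hi hin, zero_mul, zero_mul]

theorem IsAnnihilatedAt.tComm_mul {i : ℕ} (hin : i < n) {x : Fin n}
    (hx : (x : ℕ) + 1 < i) {a : MonoidAlgebra R (Perm (Fin n))} (h : IsAnnihilatedAt R i x a) :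
    IsAnnihilatedAt R i x (tComm R n i (i + 1) * a) := fun σ hσ hσx => by
  obtain ⟨l, rfl⟩ : ∃ l, i = l + 1 := ⟨i - 1, by omega⟩
  have hl : 1 ≤ l := by omega
  have hln : l < n := by omega
  let c : Fin n := ⟨l, hln⟩
  let c' : Fin n := ⟨l - 1, by omega⟩
  have hs : simpleTransposition n l = swap c' c := dif_pos ⟨hl, hln⟩
  let ρ : Perm (Fin n) := swap x c'
  have hρ : ∀ y : Fin n, l + 1 ≤ y + 1 → ρ y = y := fun y hy =>
    swap_apply_of_ne_of_ne (by simp [Fin.ext_iff]; omega) (by simp [Fin.ext_iff, c']; omega)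
  have hsc : ∀ y : Fin n, l + 2 ≤ y + 1 → simpleTransposition n l y = y := fun y hy =>
    simpleTransposition_apply_of_ne (by omega) (by omega)
  let τ : Perm (Fin n) := σ * ρ * simpleTransposition n l
  have hτ : ∀ y : Fin n, l + 1 ≤ y + 1 → τ y = y := fun y hy => by
    rcases hy.eq_or_lt with hy | hy
    · obtain rfl : y = c := Fin.ext (by simp [c]; omega)
      simp only [τ, ρ, Perm.mul_apply, hs, swap_apply_right]
      exact Fin.ext (by simp [c]; omega)
    · simp only [τ, Perm.mul_apply]
      rw [hsc y hy, hρ y (by omega), hσ y hy]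
  have hσ' : σ = τ * (simpleTransposition n l * ρ) := by
    simp only [τ, mul_assoc]
    rw [← mul_assoc (simpleTransposition n l), simpleTransposition_mul_self, one_mul,
      swap_mul_self, mul_one]
  have hzero := h (simpleTransposition n l * ρ)
    (fun y hy => by rw [Perm.mul_apply, hρ y (by omega), hsc y hy])
    (by simp [ρ, hs, c])
  rw [map_mul, mul_assoc] at hzero
  have hkey := commutator_mul_sElem_mul_commutator R hl hin hzero
  have hρ' := commute_of_tComm R hρ
  have hτ' := commute_of_tComm R hτ
  clear_value τ
  rw [hσ', map_mul, map_mul]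
  change tComm R n (l + 1) (l + 1 + 1) * (of R _ (simpleTransposition n l) *
    (tComm R n (l + 1) (l + 1 + 1) * (of R _ ρ * a))) = 0 at hkey
  generalize tComm R n (l + 1) (l + 1 + 1) = C at *
  generalize of R _ τ = T at *
  generalize of R _ ρ = P at *
  generalize of R _ (simpleTransposition n l) = S at *
  linear_combination (norm := noncomm_ring) T * hkey - hτ'.eq * S * P * C * a +
    T * C * S * hρ'.eq * a

theorem cyc_apply_of_le {i l : ℕ} (hl : 1 ≤ l) (hli : l ≤ i) (hin : i < n) (y : Fin n)
    (hy : i + 1 ≤ y + 1) : cyc n l i y = y := by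
  have := cyc_apply hl hli hin.le y
  exact Fin.ext (by split_ifs at this <;> omega)

/-- `G` bounds the positions in `[q, i]` at which `a` may fail to be annihilated; each further
commutator either annihilates or removes one of them. -/
theorem prod_tComm_mul_eq_zero {i : ℕ} (hin : i < n) (ls : List ℕ)
    (hls : ∀ l ∈ ls, 1 ≤ l ∧ l ≤ i) (a : MonoidAlgebra R (Perm (Fin n))) (q : Fin n)
    (hq : (q : ℕ) + 1 ≤ i) (G : Finset (Fin n)) (hqG : q ∉ G)
    (hG : ∀ p : Fin n, q ≤ p → (p : ℕ) + 1 ≤ i → p ∉ G → IsAnnihilatedAt R i p a)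
    (hcard : G.card < ls.length) : (ls.map fun l => tComm R n l (i + 1)).prod * a = 0 := by
  induction ls using List.reverseRecOn generalizing a q G with
  | nil => simp at hcard
  | append_singleton ls l ih =>
    obtain ⟨hl, hli⟩ := hls l (by simp)
    let c : Fin n := ⟨i - 1, by omega⟩
    have hci : (c : ℕ) + 1 = i := by simp [c]; omega
    have hμ := cyc_apply_of_le hl hli hin
    have hμ' := cyc_apply hl hli hin.le
    rw [List.map_append, List.prod_append, List.map_singleton, List.prod_singleton,
      tComm_eq_cyc_mul R hli hin, mul_assoc, mul_assoc]
    set μ := cyc n l i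
    by_cases hc : c ∈ G
    · have hqc : (q : ℕ) + 1 < i := by
        have : q ≠ c := fun h => hqG (h ▸ hc)
        rw [Ne, Fin.ext_iff] at this
        omega
      refine ih (fun l' h' => hls l' (by simp [h'])) _ (μ q) ?_ ((G.erase c).map μ.toEmbedding)
        (by simp [hqG]) (fun p hqp hpi hp => ?_) ?_
      · have := hμ' q
        split_ifs at this <;> omega
      · obtain ⟨p, rfl⟩ := μ.surjective p
        refine IsAnnihilatedAt.of_mul ?_ hμ
        by_cases hpc : p = c
        · exact isAnnihilatedAt_tComm_mul_self (by omega) hin (hpc ▸ hci) a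
        · have hpG : p ∉ G := by simpa [hpc] using hp
          rw [Fin.ext_iff] at hpc
          rw [Fin.le_def] at hqp
          have hp' := hμ' p
          have hq' := hμ' q
          have hpi' : (p : ℕ) + 1 < i := by split_ifs at hp' <;> omega
          refine (hG p ?_ hpi'.le hpG).tComm_mul hin hpi'
          rw [Fin.le_def]
          split_ifs at hp' hq' <;> omega
      · rw [Finset.card_map, Finset.card_erase_of_mem hc]
        have := Finset.card_pos.2 ⟨c, hc⟩
        simp only [List.length_append, List.length_singleton] at hcard
        omega
    · have h := hG c (by rw [Fin.le_def]; omega) hci.le hc 1 (fun _ _ => rfl) hci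
      rw [map_one, one_mul] at h
      rw [h, mul_zero, mul_zero]

end Nilpotency

theorem somewhere_to_below_left_bound_product
    (R : Type*) [CommRing R] (n : ℕ) (hn : 0 < n)
    (j : ℕ) (hj1 : 1 ≤ j) (hjn : j ≤ n)
    (m : ℕ) (hm : 0 < m)
    (k : Fin m → ℕ) (hk : ∀ r, 1 ≤ k r ∧ k r ≤ j)
    (hlast : m ≥ j - k ⟨m - 1, by omega⟩ + 1) :
    (List.ofFn (fun r : Fin m =>
        t R n (k r) * t R n j - t R n j * t R n (k r))).prod = 0 := by
  change (List.ofFn fun r => tComm R n (k r) j).prod = 0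
  by_cases hkj : ∃ r, k r = j
  · obtain ⟨r, hr⟩ := hkj
    exact List.prod_eq_zero ((List.mem_ofFn' _ _).2 ⟨r, by simp [tComm, hr]⟩)
  replace hkj : ∀ r, 1 ≤ k r ∧ k r < j := fun r =>
    ⟨(hk r).1, lt_of_le_of_ne (hk r).2 fun h => hkj ⟨r, h⟩⟩
  obtain ⟨i, rfl⟩ : ∃ i, j = i + 1 := ⟨j - 1, by omega⟩
  obtain ⟨m, rfl⟩ : ∃ m', m = m' + 1 := ⟨m - 1, by omega⟩
  change m + 1 ≥ i + 1 - k (Fin.last m) + 1 at hlast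
  obtain ⟨hl, hli⟩ := hkj (Fin.last m)
  set l := k (Fin.last m)
  have hμ := cyc_apply hl (Nat.lt_succ_iff.1 hli) (by omega : i ≤ n)
  let c : Fin n := ⟨i - 1, by omega⟩
  let q : Fin n := ⟨l - 1, by omega⟩
  have hμc : cyc n l i c = q := Fin.ext (by simp [hμ, c, q]; omega)
  rw [List.ofFn_succ', List.concat_eq_append, List.prod_append, List.prod_singleton,
    tComm_eq_cyc_mul R (Nat.lt_succ_iff.1 hli) hjn,
    ← Function.comp_def (fun l => tComm R n l (i + 1)) (fun r : Fin m => k r.castSucc),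
    ← List.map_ofFn]
  refine prod_tComm_mul_eq_zero hjn _ (fun l' h' => ?_) _ q (by simp [q]; omega)
    (Finset.Ioc q c) (by simp) (fun p hqp hpi hp => ?_) ?_
  · obtain ⟨r, rfl⟩ := (List.mem_ofFn' _ _).1 h'
    exact ⟨(hkj _).1, Nat.lt_succ_iff.1 (hkj _).2⟩
  · obtain rfl : p = q := by
      by_contra h
      exact hp (Finset.mem_Ioc.2 ⟨lt_of_le_of_ne hqp (Ne.symm h), by
        rw [Fin.le_def]; simp only [c]; omega⟩)
    rw [← hμc]
    refine IsAnnihilatedAt.of_mul ?_ (cyc_apply_of_le hl (Nat.lt_succ_iff.1 hli) hjn)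
    simpa using isAnnihilatedAt_tComm_mul_self (R := R) (by omega) hjn
      (show (c : ℕ) + 1 = i by simp [c]; omega) 1
  · simp [c, q]
    omega
end

section
/- Let i, j ∈ [n] satisfy i < j. Then in k[S_n]: (a) [t_i, t_j] = [s_i s_{i+1} ⋯ s_{j−1}, t_j] · t_j, and (b) [t_i, t_j] = (s_i s_{i+1} ⋯ s_{j−2}) · [t_{j−1}, t_j] (where the products of simple transpositions are viewed as elements of the group algebra, and the product s_i s_{i+1} ⋯ s_{j−2} is empty, hence equal to 1, when j = i+1). -/
/-- Simple transpositions whose indices differ by at least two commute. -/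
theorem simpleTransposition_commute (n : ℕ) {a b : ℕ} (h : a + 1 < b) :
    Commute (simpleTransposition n a) (simpleTransposition n b) := by
  unfold simpleTransposition
  split_ifs with ha hb
  · refine (Equiv.Perm.disjoint_swap_swap ?_).commute
    simp [Fin.ext_iff]
    omega
  · exact Commute.one_right _
  · exact Commute.one_left _
  · exact Commute.one_left _

theorem cyc_mul_cyc (n : ℕ) {u v w : ℕ} (huv : u ≤ v) (hvw : v ≤ w) :
    cyc n u v * cyc n v w = cyc n u w := by
  obtain ⟨p, rfl⟩ := Nat.exists_eq_add_of_le huv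
  obtain ⟨q, rfl⟩ := Nat.exists_eq_add_of_le hvw
  have h : u + p + q - u = p + q := by omega
  simp only [cyc, Nat.add_sub_cancel_left, h]
  rw [← List.prod_append, ← List.map_append, List.range'_append_1]

theorem cyc_commute (n : ℕ) {u v j w : ℕ} (hvj : v < j) :
    Commute (cyc n u v) (cyc n j w) := by
  refine Commute.list_prod_left _ _ fun x hx => Commute.list_prod_right _ _ fun y hy => ?_
  obtain ⟨a, ha, rfl⟩ := List.mem_map.1 hx
  obtain ⟨b, hb, rfl⟩ := List.mem_map.1 hy
  rw [List.mem_range'_1] at ha hb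
  exact simpleTransposition_commute n (by omega)

theorem of_cyc_commute_t (R : Type*) [CommRing R] (n : ℕ) {u v j : ℕ} (hvj : v < j) :
    Commute (MonoidAlgebra.of R (Equiv.Perm (Fin n)) (cyc n u v)) (t R n j) :=
  Commute.sum_right _ _ _ fun _ _ => (cyc_commute n hvj).map (MonoidAlgebra.of R _)

/-- The shuffle `t_i` splits into the cycles ending before `j` and a multiple of `t_j`. -/
theorem t_eq_sum_add (R : Type*) [CommRing R] (n : ℕ) {i j : ℕ} (hij : i ≤ j) (hjn : j ≤ n) :
    t R n i = ∑ w ∈ Finset.Ico i j, MonoidAlgebra.of R (Equiv.Perm (Fin n)) (cyc n i w)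
      + MonoidAlgebra.of R (Equiv.Perm (Fin n)) (cyc n i j) * t R n j := by
  have key : MonoidAlgebra.of R (Equiv.Perm (Fin n)) (cyc n i j) * t R n j
      = ∑ w ∈ Finset.Ico j (n + 1), MonoidAlgebra.of R (Equiv.Perm (Fin n)) (cyc n i w) := by
    rw [t, Finset.mul_sum]
    refine Finset.sum_congr rfl fun w hw => ?_
    rw [← map_mul, cyc_mul_cyc n hij (Finset.mem_Icc.1 hw).1]
  rw [key, Finset.sum_Ico_consecutive _ hij (by omega)]
  rfl

theorem t_commutator_eq (R : Type*) [CommRing R] (n : ℕ) {i j : ℕ} (hij : i < j) (hjn : j ≤ n) :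
    t R n i * t R n j - t R n j * t R n i
      = (MonoidAlgebra.of R (Equiv.Perm (Fin n)) (cyc n i j) * t R n j
          - t R n j * MonoidAlgebra.of R (Equiv.Perm (Fin n)) (cyc n i j)) * t R n j := by
  have h : Commute (∑ w ∈ Finset.Ico i j, MonoidAlgebra.of R (Equiv.Perm (Fin n)) (cyc n i w))
      (t R n j) :=
    Commute.sum_left _ _ _ fun w hw => of_cyc_commute_t R n (Finset.mem_Ico.1 hw).2
  rw [t_eq_sum_add R n hij.le hjn, add_mul, mul_add, h.eq, sub_mul, ← mul_assoc]
  abel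

theorem comm_ti_tj_rewrite
    (R : Type*) [CommRing R] (n : ℕ) (hn : 0 < n)
    (i j : ℕ) (hi1 : 1 ≤ i) (hij : i < j) (hjn : j ≤ n) :
    (t R n i * t R n j - t R n j * t R n i
      = (MonoidAlgebra.of R (Equiv.Perm (Fin n))
            (((List.range' i (j - i)).map (simpleTransposition n)).prod) * t R n j
          - t R n j * MonoidAlgebra.of R (Equiv.Perm (Fin n))
            (((List.range' i (j - i)).map (simpleTransposition n)).prod))
        * t R n j) ∧
    (t R n i * t R n j - t R n j * t R n i
      = MonoidAlgebra.of R (Equiv.Perm (Fin n))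
          (((List.range' i (j - 1 - i)).map (simpleTransposition n)).prod)
        * (t R n (j - 1) * t R n j - t R n j * t R n (j - 1))) := by
  refine ⟨t_commutator_eq R n hij hjn, ?_⟩
  change _ = MonoidAlgebra.of R (Equiv.Perm (Fin n)) (cyc n i (j - 1)) * _
  have h := of_cyc_commute_t R n (u := i) (show j - 1 < j by omega)
  rw [t_commutator_eq R n hij hjn, t_commutator_eq R n (show j - 1 < j by omega) hjn,
    ← cyc_mul_cyc n (show i ≤ j - 1 by omega) (Nat.sub_le j 1), map_mul, ← mul_assoc (t R n j),
    ← h.eq]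
  simp only [mul_sub, sub_mul, mul_assoc]
end
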